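/- For every integer t ≥ ℓ − 1, the S-module S/(I_X ∩ ⟨x⟩^t) has projective dimension exactly n + m (equivalently, its minimal free resolution over S has length n + m). -/

import Mathlib

open MvPolynomial CategoryTheory

noncomputable section

/-- The Cox ring `S = k[x_0,…,x_n, y_0,…,y_m]` of `ℙⁿ × ℙᵐ`. -/
abbrev Cox (k : Type) [Field k] (n m : ℕ) : Type :=
  MvPolynomial (Fin (n + 1) ⊕ Fin (m + 1)) k

variable {k : Type} [Field k] {n m : ℕ}

/-- The vanishing ideal `⟨a_i x_0 - x_i : 1 ≤ i ≤ n⟩` of the point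
`[1 : a_1 : ⋯ : a_n] ∈ ℙⁿ`. -/
def Ia (n m : ℕ) (a : Fin n → k) : Ideal (Cox k n m) :=
  Ideal.span (Set.range fun i : Fin n =>
    C (a i) * X (Sum.inl 0) - X (Sum.inl i.succ))

/-- The vanishing ideal `⟨b_j y_0 - y_j : 1 ≤ j ≤ m⟩` of the point
`[1 : b_1 : ⋯ : b_m] ∈ ℙᵐ`. -/
def Ib (n m : ℕ) (b : Fin m → k) : Ideal (Cox k n m) :=
  Ideal.span (Set.range fun j : Fin m =>
    C (b j) * X (Sum.inr 0) - X (Sum.inr j.succ))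

/-- The ideal `⟨x_0, …, x_n⟩`. -/
def xIdeal (k : Type) [Field k] (n m : ℕ) : Ideal (Cox k n m) :=
  Ideal.span (Set.range fun i : Fin (n + 1) => (X (Sum.inl i) : Cox k n m))

/-- The ideal `I_{X_a} = I_{P_a} + ⋂_j I_{Q_{a,j}}` of the fiber `X_a` of `X` over the
point `P_a ∈ ℙⁿ`. -/
def IXk {ℓ : ℕ} (n m : ℕ) (P : Fin ℓ → Fin n → k) (r : Fin ℓ → ℕ)
    (Q : (a : Fin ℓ) → Fin (r a) → Fin m → k) (a : Fin ℓ) : Ideal (Cox k n m) :=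
  Ia n m (P a) + ⨅ j : Fin (r a), Ib n m (Q a j)

/-- A module `M` has projective dimension at most `d` iff `Ext^{d+1}(M, N) = 0` for
all modules `N`.  We use this standard homological characterization to express
projective dimension. -/
def ExtVanishes (S : Type) [CommRing S] (M : ModuleCat S) (e : ℕ) : Prop :=
  ∀ N : ModuleCat S, Subsingleton (((Ext S (ModuleCat S) e).obj (Opposite.op M)).obj N)


lemma extV_iff (S : Type) [CommRing S] (M : ModuleCat.{0} S) (e : ℕ) :
    ExtVanishes S M (e+1) ↔ HasProjectiveDimensionLT M (e+1) := by
  have key : ∀ N : ModuleCat.{0} S,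
      Subsingleton (((Ext S (ModuleCat S) (e+1)).obj (Opposite.op M)).obj N) ↔
      Subsingleton (Abelian.Ext M N (e+1)) := by
    intro N
    let R := ProjectiveResolution.of M
    rw [← ModuleCat.isZero_iff_subsingleton, (R.isoExt (R := S) (e+1) N).isZero_iff,
      ← HomologicalComplex.exactAt_iff_isZero_homology,
      HomologicalComplex.exactAt_iff' _ e (e+1) (e+2) (by simp) (by simp),
      ShortComplex.moduleCat_exact_iff]
    constructor
    · intro h
      refine ⟨fun α β => ?_⟩
      suffices ∀ α : Abelian.Ext M N (e+1), α = 0 by rw [this α, this β]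
      intro α
      obtain ⟨f, hf, rfl⟩ := R.extMk_surjective α (e+2) rfl
      rw [R.extMk_eq_zero_iff f (e+2) rfl hf e rfl]
      exact h f hf
    · intro h x hx
      have := Subsingleton.elim (R.extMk x (e+2) rfl hx) 0
      rw [R.extMk_eq_zero_iff x (e+2) rfl hx e rfl] at this
      exact this
  constructor
  · intro h
    exact hasProjectiveDimensionLT_of_enoughInjectives M (e+1) fun Y => (key Y).1 (h Y)
  · intro h N
    exact (key N).2 (HasProjectiveDimensionLT.subsingleton M (e+1) (e+1) le_rfl N)

/-- pd of the cyclic module. -/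
abbrev PdLT {S : Type} [CommRing S] (I : Ideal S) (d : ℕ) : Prop :=
  HasProjectiveDimensionLT (ModuleCat.of S (S ⧸ I)) d

section ses
variable {S : Type} [CommRing S] (I C Q : Ideal S) (f : S)
  (hC : ∀ g, g * f ∈ I ↔ g ∈ C) (hQ : Q = I ⊔ Ideal.span {f})

abbrev sesF (hC : ∀ g, g * f ∈ I ↔ g ∈ C) : (S ⧸ C) →ₗ[S] (S ⧸ I) :=
  Submodule.mapQ C I (LinearMap.toSpanSingleton S S f) (fun g hg => by
    simpa using (hC g).2 hg)

abbrev sesG (hQ : Q = I ⊔ Ideal.span {f}) : (S ⧸ I) →ₗ[S] (S ⧸ Q) :=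
  Submodule.mapQ I Q LinearMap.id (fun g hg => by
    rw [hQ]; exact Ideal.mem_sup_left hg)

abbrev sesC : ShortComplex (ModuleCat.{0} S) :=
  ShortComplex.mk (ModuleCat.ofHom (sesF I C f hC)) (ModuleCat.ofHom (sesG I Q f hQ)) (by
    ext
    simp only [ModuleCat.hom_comp, ModuleCat.hom_ofHom, LinearMap.comp_apply]
    simp only [Submodule.mkQ_apply, Submodule.mapQ_apply]
    simp
    rw [Ideal.Quotient.eq_zero_iff_mem, hQ]
    exact Ideal.mem_sup_right (Ideal.mem_span_singleton_self f))

lemma sesC_exact : (sesC I C Q f hC hQ).ShortExact where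
  exact := by
    rw [ShortComplex.ShortExact.moduleCat_exact_iff_function_exact]
    intro y
    obtain ⟨y, rfl⟩ := Submodule.mkQ_surjective _ y
    constructor
    · intro h
      have h : y ∈ Q := by
        simpa [Ideal.Quotient.eq_zero_iff_mem] using h
      rw [hQ, sup_comm] at h
      obtain ⟨a, b, hb, rfl⟩ := Ideal.mem_span_singleton_sup.1 h
      refine ⟨Submodule.Quotient.mk a, ?_⟩
      change Ideal.Quotient.mk I (a * f) = Ideal.Quotient.mk I (a * f + b)
      rw [map_add, Ideal.Quotient.eq_zero_iff_mem.2 hb, add_zero]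
    · rintro ⟨x, hx⟩
      obtain ⟨x, rfl⟩ := Submodule.mkQ_surjective _ x
      rw [← hx]
      exact congrArg (fun φ => φ.hom (Submodule.mkQ C x)) (sesC I C Q f hC hQ).zero
  mono_f := by
    rw [ModuleCat.mono_iff_injective]
    refine (injective_iff_map_eq_zero (sesF I C f hC)).2 ?_
    intro x hx
    obtain ⟨x, rfl⟩ := Submodule.mkQ_surjective _ x
    have : x * f ∈ I := Ideal.Quotient.eq_zero_iff_mem.1 hx
    simpa [Ideal.Quotient.eq_zero_iff_mem] using (hC x).1 this
  epi_g := by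
    rw [ModuleCat.epi_iff_surjective]
    intro y
    obtain ⟨y, rfl⟩ := Submodule.mkQ_surjective _ y
    exact ⟨Submodule.Quotient.mk y, rfl⟩

include hC hQ in
lemma pd_mid {d : ℕ} (h1 : PdLT C d) (h3 : PdLT Q d) : PdLT I d :=
  (sesC_exact I C Q f hC hQ).hasProjectiveDimensionLT_X₂ d h1 h3

include hC hQ in
lemma pd_left {d : ℕ} (h1 : PdLT I d) (h3 : PdLT Q (d+1)) : PdLT C d :=
  (sesC_exact I C Q f hC hQ).hasProjectiveDimensionLT_X₁ d h1 h3

include hC hQ in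
lemma pd_right {d : ℕ} (h1 : PdLT C d) (h3 : PdLT I (d+1)) : PdLT Q (d+1) :=
  (sesC_exact I C Q f hC hQ).hasProjectiveDimensionLT_X₃ d h1 h3

lemma ext_step (N : Type) [AddCommGroup N] [Module S N]
    (hN : f ∈ Module.annihilator S N) (hI : ∀ g, g * f ∈ I ↔ g ∈ I)
    (hQ : Q = I ⊔ Ideal.span {f}) (d : ℕ)
    (h : Subsingleton (Abelian.Ext (ModuleCat.of S (S ⧸ Q)) (ModuleCat.of S N) (d+1))) :
    Subsingleton (Abelian.Ext (ModuleCat.of S (S ⧸ I)) (ModuleCat.of S N) d) := by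
  refine subsingleton_of_forall_eq 0 fun x => ?_
  obtain ⟨y, rfl⟩ := Abelian.Ext.contravariant_sequence_exact₁ (sesC_exact I I Q f hI hQ)
    (ModuleCat.of S N) x (add_comm 1 d) (h.elim _ _)
  have e : (sesC I I Q f hI hQ).f = f • 𝟙 _ := by
    apply ModuleCat.hom_ext
    refine LinearMap.ext fun x => ?_
    obtain ⟨x, rfl⟩ := Submodule.mkQ_surjective _ x
    change Ideal.Quotient.mk I (x * f) = Ideal.Quotient.mk I (f * x)
    rw [mul_comm]
  rw [e, Abelian.Ext.mk₀_smul, Abelian.Ext.smul_comp, Abelian.Ext.mk₀_id_comp]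
  rw [← Abelian.Ext.comp_mk₀_id y, ← Abelian.Ext.comp_smul, ← Abelian.Ext.mk₀_smul]
  have : f • 𝟙 (ModuleCat.of S N) = 0 := by
    ext z
    exact Module.mem_annihilator.1 hN z
  rw [this]
  simp
end ses

lemma pd_top {S : Type} [CommRing S] (d : ℕ) : PdLT (⊤ : Ideal S) d := by
  have : Subsingleton (S ⧸ (⊤ : Ideal S)) := Ideal.Quotient.subsingleton_iff.2 rfl
  have := (ModuleCat.isZero_of_subsingleton (ModuleCat.of S (S ⧸ (⊤ : Ideal S)))).hasProjectiveDimensionLT_zero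
  exact hasProjectiveDimensionLT_of_ge _ 0 d (by simp)

lemma pd_bot {S : Type} [CommRing S] : PdLT (⊥ : Ideal S) 1 := by
  have : Module.Projective S (S ⧸ (⊥ : Ideal S)) :=
    Module.Projective.of_equiv (Submodule.quotEquivOfEqBot (⊥ : Ideal S) rfl).symm
  have : Projective (ModuleCat.of S (S ⧸ (⊥ : Ideal S))) := (IsProjective.iff_projective _).1 this
  infer_instance

lemma pd_mono {S : Type} [CommRing S] {I : Ideal S} {d e : ℕ} (h : PdLT I d) (hde : d ≤ e) : PdLT I e :=
  hasProjectiveDimensionLT_of_ge _ d e hde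

lemma ext_bot {S : Type} [CommRing S] (N : Type) [AddCommGroup N] [Module S N] [Nontrivial N] :
    ¬ Subsingleton (Abelian.Ext (ModuleCat.of S (S ⧸ (⊥ : Ideal S))) (ModuleCat.of S N) 0) := by
  intro h
  have : Subsingleton ((S ⧸ (⊥ : Ideal S)) →ₗ[S] N) :=
    ((Abelian.Ext.addEquiv₀ (X := ModuleCat.of S (S ⧸ (⊥ : Ideal S)))
      (Y := ModuleCat.of S N)).trans ModuleCat.homAddEquiv).symm.subsingleton
  obtain ⟨x, hx⟩ := exists_ne (0 : N)
  apply hx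
  have := congrArg (fun φ => φ (Submodule.Quotient.mk 1)) (Subsingleton.elim
    ((LinearMap.toSpanSingleton S N x) ∘ₗ (Submodule.quotEquivOfEqBot (⊥ : Ideal S) rfl).toLinearMap) 0)
  change (1 : S) • x = 0 at this
  rwa [one_smul] at this


section lin
variable {k : Type} [Field k] {σ : Type} [DecidableEq σ]

/-- Substitute the variables in `T`. -/
def sub (c : σ → k) (p : σ → σ) (T : Finset σ) : MvPolynomial σ k →ₐ[k] MvPolynomial σ k :=
  aeval (fun i => if i ∈ T then C (c i) * X (p i) else X i)

def linI (c : σ → k) (p : σ → σ) (T : Finset σ) : Ideal (MvPolynomial σ k) :=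
  Ideal.span ((fun i => C (c i) * X (p i) - X i) '' (T : Set σ))

variable (c : σ → k) (p : σ → σ) (T : Finset σ)

lemma sub_X_mem {i : σ} (h : i ∈ T) : sub c p T (X i) = C (c i) * X (p i) := by
  simp [sub, h]

lemma sub_X_not_mem {i : σ} (h : i ∉ T) : sub c p T (X i) = X i := by
  simp [sub, h]

lemma sub_C (a : k) : sub c p T (C a) = C a := by
  simp [sub]

lemma sub_sub_mem (g : MvPolynomial σ k) : g - sub c p T g ∈ linI c p T := by
  have : (Ideal.Quotient.mkₐ k (linI c p T)).comp (sub c p T) = Ideal.Quotient.mkₐ k (linI c p T) := by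
    apply MvPolynomial.algHom_ext
    intro i
    by_cases h : i ∈ T
    · simp only [AlgHom.comp_apply, sub_X_mem _ _ _ h]
      refine Ideal.Quotient.eq.2 (Ideal.subset_span ⟨i, h, rfl⟩)
    · simp only [AlgHom.comp_apply, sub_X_not_mem _ _ _ h]
  have := congrArg (fun φ => φ g) this
  exact Ideal.Quotient.eq.1 this.symm

lemma mem_linI (hp : ∀ i ∈ T, p i ∉ T) (g : MvPolynomial σ k) :
    g ∈ linI c p T ↔ sub c p T g = 0 := by
  constructor
  · intro h
    have : linI c p T ≤ RingHom.ker (sub c p T) := by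
      rw [linI, Ideal.span_le]
      rintro _ ⟨i, hi, rfl⟩
      simp only [SetLike.mem_coe, RingHom.mem_ker, map_sub, map_mul, sub_C,
        sub_X_not_mem _ _ _ (hp i hi), sub_X_mem _ _ _ hi, sub_self]
    exact this h
  · intro h
    simpa [h] using sub_sub_mem c p T g

lemma linI_prime (hp : ∀ i ∈ T, p i ∉ T) : (linI c p T).IsPrime := by
  have : linI c p T = RingHom.ker (sub c p T) := by
    ext g; rw [mem_linI _ _ _ hp, RingHom.mem_ker]
  rw [this]
  exact RingHom.ker_isPrime _

lemma lin_ne {i j : σ} (h : j ≠ i) (a : k) : (C a * X j - X i : MvPolynomial σ k) ≠ 0 := by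
  intro h0
  have := congrArg (coeff (Finsupp.single i 1)) h0
  rw [coeff_sub, coeff_C_mul, coeff_X, coeff_X] at this
  simp [Finsupp.single_left_inj, h] at this

/-- the residue field at the origin -/
abbrev resid (k σ : Type) [Field k] : Type :=
  MvPolynomial σ k ⧸ (RingHom.ker (constantCoeff (σ := σ) (R := k)))

instance : Nontrivial (resid k σ) := by
  apply Ideal.Quotient.nontrivial_iff.2
  exact RingHom.ker_ne_top _

lemma idl_prime_mul_iff {S : Type} [CommRing S] {I : Ideal S} (hI : I.IsPrime) {f : S} (hf : f ∉ I)
    (g : S) : g * f ∈ I ↔ g ∈ I :=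
  ⟨fun h => (hI.mem_or_mem h).resolve_right hf, fun h => I.mul_mem_right f h⟩

lemma linI_main (T₀ : Finset σ) (hp : ∀ i ∈ T₀, p i ∉ T₀) (hT : T ⊆ T₀) :
    PdLT (linI c p T) (T.card + 1) ∧
    ¬ Subsingleton (Abelian.Ext (ModuleCat.of (MvPolynomial σ k) (MvPolynomial σ k ⧸ linI c p T))
      (ModuleCat.of (MvPolynomial σ k) (resid k σ)) T.card) := by
  induction T using Finset.induction_on with
  | empty =>
    have : linI c p ∅ = ⊥ := by simp [linI]
    rw [this]
    exact ⟨pd_bot, ext_bot _⟩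
  | insert i T hi ih =>
    have hi0 : i ∈ T₀ := hT (Finset.mem_insert_self _ _)
    have hT' : T ⊆ T₀ := fun j hj => hT (Finset.mem_insert_of_mem hj)
    obtain ⟨h1, h2⟩ := ih hT'
    have hpT : ∀ j ∈ T, p j ∉ T := fun j hj h => hp j (hT' hj) (hT' h)
    have hQ : linI c p (insert i T) = linI c p T ⊔ Ideal.span {C (c i) * X (p i) - X i} := by
      rw [linI, linI, ← Ideal.span_union, Finset.coe_insert, Set.image_insert_eq, Set.union_singleton]
    have hf : C (c i) * X (p i) - X i ∉ linI c p T := by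
      rw [mem_linI _ _ _ hpT]
      simp only [map_sub, map_mul, sub_C, sub_X_not_mem _ _ _ hi,
        sub_X_not_mem c p T (fun h => hp i hi0 (hT' h))]
      exact lin_ne (fun h => hp i hi0 (by rw [h]; exact hi0)) _
    have hC := idl_prime_mul_iff (linI_prime c p T hpT) hf
    rw [Finset.card_insert_of_notMem hi]
    refine ⟨pd_right _ _ _ _ hC hQ h1 (pd_mono h1 (by omega)), fun h => h2 ?_⟩
    refine ext_step _ _ _ _ ?_ hC hQ _ h
    rw [Ideal.annihilator_quotient, RingHom.mem_ker]
    simp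

lemma linI_not (T₀ : Finset σ) (hp : ∀ i ∈ T₀, p i ∉ T₀) : ¬ PdLT (linI c p T₀) T₀.card :=
  fun h => (linI_main c p T₀ T₀ hp subset_rfl).2 (HasProjectiveDimensionLT.subsingleton _ _ _ le_rfl _)
end lin

section pow
variable {k : Type} [Field k] {σ : Type} [DecidableEq σ]

def degI (k : Type) [Field k] (T : Finset σ) (t : ℕ) : Ideal (MvPolynomial σ k) where
  carrier := {f | ∀ d ∈ f.support, t ≤ ∑ i ∈ T, d i}
  zero_mem' := by simp
  add_mem' := by
    intro a b ha hb d hd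
    rcases Finset.mem_union.1 (support_add hd) with h | h
    · exact ha d h
    · exact hb d h
  smul_mem' := by
    intro a b hb d hd
    obtain ⟨u, _, v, hv, rfl⟩ := Finset.mem_add.1 (support_mul a b hd)
    refine (hb v hv).trans (Finset.sum_le_sum fun i _ => ?_)
    simp

lemma mem_degI {T : Finset σ} {t : ℕ} {f : MvPolynomial σ k} :
    f ∈ degI k T t ↔ ∀ d ∈ f.support, t ≤ ∑ i ∈ T, d i := Iff.rfl

lemma degI_mul_X_mem {T : Finset σ} {t : ℕ} {i : σ} (hi : i ∈ T) (g : MvPolynomial σ k) :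
    g * X i ∈ degI k T (t+1) ↔ g ∈ degI k T t := by
  simp only [mem_degI, support_mul_X, Finset.mem_map, addRightEmbedding_apply, forall_exists_index,
    and_imp, forall_apply_eq_imp_iff₂, Finsupp.add_apply, Finset.sum_add_distrib]
  simp [Finsupp.single_apply, hi]

lemma degI_mul_X_not_mem {T : Finset σ} {t : ℕ} {i : σ} (hi : i ∉ T) (g : MvPolynomial σ k) :
    g * X i ∈ degI k T t ↔ g ∈ degI k T t := by
  simp only [mem_degI, support_mul_X, Finset.mem_map, addRightEmbedding_apply, forall_exists_index,
    and_imp, forall_apply_eq_imp_iff₂, Finsupp.add_apply, Finset.sum_add_distrib]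
  simp [Finsupp.single_apply, hi]

lemma mem_of_monomials {I : Ideal (MvPolynomial σ k)} {f : MvPolynomial σ k}
    (h : ∀ d ∈ f.support, monomial d 1 ∈ I) : f ∈ I := by
  rw [f.as_sum]
  refine Ideal.sum_mem _ fun d hd => ?_
  have : monomial d (coeff d f) = C (coeff d f) * monomial d 1 := by simp [C_mul_monomial]
  rw [this]
  exact I.mul_mem_left _ (h d hd)

lemma monomial_mem_degI {T : Finset σ} {t : ℕ} {d : σ →₀ ℕ} :
    monomial d (1 : k) ∈ degI k T t ↔ t ≤ ∑ i ∈ T, d i := by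
  classical
  simp [mem_degI, support_monomial]

lemma X_dvd_mem {d : σ →₀ ℕ} {i : σ} (h : d i ≠ 0) {I : Ideal (MvPolynomial σ k)} (hI : X i ∈ I) :
    monomial d (1 : k) ∈ I := by
  have : X i ∣ monomial d (1 : k) := by
    rw [X_dvd_monomial]; right; exact h
  exact Ideal.mem_of_dvd _ this hI

lemma degI_sup {T : Finset σ} {t : ℕ} {i : σ} (hi : i ∉ T) :
    degI k (insert i T) t ⊔ Ideal.span {X i} = degI k T t ⊔ Ideal.span {X i} := by
  apply le_antisymm
  · refine sup_le (fun f hf => mem_of_monomials fun d hd => ?_) le_sup_right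
    by_cases h : d i = 0
    · apply Ideal.mem_sup_left
      rw [monomial_mem_degI]
      have := hf d hd
      rwa [Finset.sum_insert hi, h, zero_add] at this
    · exact X_dvd_mem h (Ideal.mem_sup_right (Ideal.mem_span_singleton_self _))
  · refine sup_le_sup_right (fun f hf d hd => ?_) _
    rw [Finset.sum_insert hi]
    exact (hf d hd).trans (by omega)

lemma degI_zero (T : Finset σ) : degI k T 0 = ⊤ := by
  rw [eq_top_iff]; intro f _ d _; simp

lemma degI_pd (T : Finset σ) (t : ℕ) : PdLT (degI k T t) (T.card + 1) := by
  induction T using Finset.induction_on generalizing t with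
  | empty =>
    rcases t with _ | t
    · rw [degI_zero]; exact pd_top _
    · have : degI k (∅ : Finset σ) (t+1) = ⊥ := by
        rw [eq_bot_iff]
        intro f hf
        rw [Ideal.mem_bot, ← support_eq_empty, Finset.eq_empty_iff_forall_notMem]
        intro d hd
        simpa using hf d hd
      rw [this]; exact pd_bot
  | insert i T hi ih =>
    induction t with
    | zero => rw [degI_zero]; exact pd_top _
    | succ t iht =>
      refine pd_mid _ _ _ (X i) (degI_mul_X_mem (Finset.mem_insert_self i T)) (degI_sup hi).symm iht ?_
      rw [Finset.card_insert_of_notMem hi]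
      exact pd_right (degI k T (t+1)) (degI k T (t+1)) _ (X i) (degI_mul_X_not_mem hi) rfl (ih _) 
        (pd_mono (ih _) (by omega))

lemma degI_mul (T : Finset σ) (s t : ℕ) : degI k T s * degI k T t ≤ degI k T (s + t) := by
  rw [Ideal.mul_le]
  intro f hf g hg d hd
  obtain ⟨u, hu, v, hv, rfl⟩ := Finset.mem_add.1 (support_mul f g hd)
  simp only [Finsupp.add_apply, Finset.sum_add_distrib]
  exact add_le_add (hf u hu) (hg v hv)

lemma degI_eq (T : Finset σ) (t : ℕ) :
    degI k T t = Ideal.span ((fun i => (X i : MvPolynomial σ k)) '' (T : Set σ)) ^ t := by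
  apply le_antisymm
  · intro f hf
    apply mem_of_monomials
    intro d hd
    have := hf d hd
    clear hf hd
    induction t generalizing d with
    | zero => simp
    | succ t ih =>
      obtain ⟨i, hi, h⟩ : ∃ i ∈ T, d i ≠ 0 := by
        by_contra! h
        rw [Finset.sum_eq_zero h] at this
        omega
      obtain ⟨e, rfl⟩ : ∃ e, d = e + Finsupp.single i 1 :=
        ⟨d - Finsupp.single i 1, (tsub_add_cancel_of_le (by
          rw [Finsupp.single_le_iff]; omega)).symm⟩
      have e1 : monomial (e + Finsupp.single i 1) (1 : k) = monomial e 1 * X i := by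
        rw [X, monomial_mul, one_mul]
      rw [e1, pow_succ]
      refine Ideal.mul_mem_mul (ih e ?_) (Ideal.subset_span ⟨i, hi, rfl⟩)
      simp only [Finsupp.add_apply, Finset.sum_add_distrib, Finsupp.single_apply] at this
      simp [hi] at this
      exact this
  · induction t with
    | zero => rw [degI_zero]; exact le_top
    | succ t ih =>
      rw [pow_succ]
      refine (Ideal.mul_mono ih ?_).trans (degI_mul T t 1)
      rw [Ideal.span_le]
      rintro _ ⟨i, hi, rfl⟩
      have := (degI_mul_X_mem (k := k) (t := 0) hi 1).2 (by rw [degI_zero]; trivial)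
      simpa using this
end pow

section final

/-- scalars -/
def cc (a : Fin n → k) (b : Fin m → k) : Fin (n + 1) ⊕ Fin (m + 1) → k :=
  Sum.elim (Fin.cons 0 a) (Fin.cons 0 b)

def pp (n m : ℕ) : Fin (n + 1) ⊕ Fin (m + 1) → Fin (n + 1) ⊕ Fin (m + 1) :=
  Sum.elim (fun _ => Sum.inl 0) (fun _ => Sum.inr 0)

def TA (n m : ℕ) : Finset (Fin (n + 1) ⊕ Fin (m + 1)) :=
  Finset.univ.image (fun i : Fin n => Sum.inl i.succ)

def TB (n m : ℕ) : Finset (Fin (n + 1) ⊕ Fin (m + 1)) :=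
  Finset.univ.image (fun i : Fin m => Sum.inr i.succ)

lemma inl0_TA : (Sum.inl 0 : Fin (n + 1) ⊕ Fin (m + 1)) ∉ TA n m := by
  simp [TA, Fin.succ_ne_zero]
lemma inr_TA (j) : (Sum.inr j : Fin (n + 1) ⊕ Fin (m + 1)) ∉ TA n m := by
  simp [TA]
lemma inl_TB (j) : (Sum.inl j : Fin (n + 1) ⊕ Fin (m + 1)) ∉ TB n m := by
  simp [TB]
lemma inr0_TB : (Sum.inr 0 : Fin (n + 1) ⊕ Fin (m + 1)) ∉ TB n m := by
  simp [TB, Fin.succ_ne_zero]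

lemma hpAB : ∀ i ∈ TA n m ∪ TB n m, pp n m i ∉ TA n m ∪ TB n m := by
  rintro (i | i) _
  · simp [pp, inl0_TA, inl_TB]
  · simp [pp, inr_TA, inr0_TB]

lemma hpA : ∀ i ∈ TA n m, pp n m i ∉ TA n m := fun i hi h =>
  hpAB i (Finset.mem_union_left _ hi) (Finset.mem_union_left _ h)
lemma hpB : ∀ i ∈ TB n m, pp n m i ∉ TB n m := fun i hi h =>
  hpAB i (Finset.mem_union_right _ hi) (Finset.mem_union_right _ h)

lemma card_AB : (TA n m ∪ TB n m).card = n + m := by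
  rw [Finset.card_union_of_disjoint, TA, TB, Finset.card_image_of_injective,
    Finset.card_image_of_injective]
  · simp
  · intro i j h; simpa using h
  · intro i j h; simpa using h
  · rw [Finset.disjoint_left]
    rintro (i | i) h
    · simp [inl_TB]
    · exact absurd h (inr_TA i)

lemma Ia_eq (a : Fin n → k) (b : Fin m → k) : Ia n m a = linI (cc a b) (pp n m) (TA n m) := by
  rw [Ia, linI]
  congr 1
  ext g
  simp [TA, cc, pp]

lemma Ib_eq (a : Fin n → k) (b : Fin m → k) : Ib n m b = linI (cc a b) (pp n m) (TB n m) := by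
  rw [Ib, linI]
  congr 1
  ext g
  simp [TB, cc, pp]

lemma Iab_eq (a : Fin n → k) (b : Fin m → k) :
    Ia n m a ⊔ Ib n m b = linI (cc a b) (pp n m) (TA n m ∪ TB n m) := by
  rw [Ia_eq a b, Ib_eq a b, linI, linI, linI, ← Ideal.span_union, ← Set.image_union,
    Finset.coe_union]

lemma Ib_prime (b : Fin m → k) : (Ib n m b).IsPrime := by
  rw [Ib_eq 0 b]; exact linI_prime _ _ _ hpB

lemma Iab_prime (a : Fin n → k) (b : Fin m → k) : (Ia n m a ⊔ Ib n m b).IsPrime := by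
  rw [Iab_eq a b]; exact linI_prime _ _ _ hpAB

lemma Ib_le_Iab {a : Fin n → k} {b b' : Fin m → k} (h : Ib n m b' ≤ Ia n m a ⊔ Ib n m b) :
    b' = b := by
  funext j
  have : (C (b' j) * X (Sum.inr 0) - X (Sum.inr j.succ) : Cox k n m) ∈ Ib n m b' :=
    Ideal.subset_span ⟨j, rfl⟩
  have := h this
  rw [Iab_eq, mem_linI _ _ _ hpAB, map_sub, map_mul, sub_C,
    sub_X_not_mem _ _ _ (by simp [inr_TA, inr0_TB]), sub_X_mem _ _ _ (by simp [TB])] at this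
  simp only [cc, pp, Sum.elim_inr, Fin.cons_succ, ← sub_mul, ← C_sub] at this
  rcases mul_eq_zero.1 this with h | h
  · rw [C_eq_zero] at h
    exact sub_eq_zero.1 h
  · exact absurd h (X_ne_zero _)

/-- The ideal of a point in the `y`-ring. -/
def IB (b : Fin m → k) : Ideal (MvPolynomial (Fin (m + 1)) k) :=
  linI (Fin.cons 0 b) (fun _ => 0) (Finset.univ.image Fin.succ)

lemma map_IB (b : Fin m → k) :
    Ideal.map (rename (R := k) (Sum.inr : Fin (m+1) → Fin (n+1) ⊕ Fin (m+1))) (IB b) = Ib n m b := by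
  rw [IB, Ib, linI, Ideal.map_span]
  congr 1
  ext g
  simp
  constructor
  · rintro ⟨a, ha, rfl⟩
    obtain ⟨y, rfl⟩ := Fin.exists_succ_eq.2 ha
    exact ⟨y, by simp⟩
  · rintro ⟨y, rfl⟩
    exact ⟨y.succ, Fin.succ_ne_zero y, by simp⟩

lemma map_inf {ι : Type} (s : Finset ι) (J : ι → Ideal (MvPolynomial (Fin (m + 1)) k)) :
    (s.inf fun i => Ideal.map (rename (R := k) (Sum.inr : Fin (m+1) → Fin (n+1) ⊕ Fin (m+1))) (J i)) ≤
      Ideal.map (rename (R := k) (Sum.inr : Fin (m+1) → Fin (n+1) ⊕ Fin (m+1))) (s.inf J) := by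
  let e := sumAlgEquiv k (Fin (n+1)) (Fin (m+1))
  have he : ∀ f, e (rename (R := k) (Sum.inr : Fin (m+1) → Fin (n+1) ⊕ Fin (m+1)) f) = C f := by
    intro f
    have : e.toAlgHom.comp (rename (R := k) (Sum.inr : Fin (m+1) → Fin (n+1) ⊕ Fin (m+1))) =
        (IsScalarTower.toAlgHom k (MvPolynomial (Fin (m+1)) k) (MvPolynomial (Fin (n+1)) (MvPolynomial (Fin (m+1)) k))) := by
      apply MvPolynomial.algHom_ext
      intro i
      simp [e, MvPolynomial.algebraMap_eq]
    exact congrArg (fun φ => φ f) this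
  have key : ∀ (J : Ideal (MvPolynomial (Fin (m + 1)) k)) g,
      g ∈ Ideal.map (rename (R := k) (Sum.inr : Fin (m+1) → Fin (n+1) ⊕ Fin (m+1))) J ↔
      e g ∈ Ideal.map (C (σ := Fin (n+1))) J := by
    intro J g
    constructor
    · intro h
      have h1 : Ideal.map (rename (R := k) (Sum.inr : Fin (m+1) → Fin (n+1) ⊕ Fin (m+1))) J ≤
          Ideal.comap e (Ideal.map (C (σ := Fin (n+1))) J) := by
        rw [Ideal.map_le_iff_le_comap]
        intro f hf
        rw [Ideal.mem_comap, Ideal.mem_comap, he]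
        exact Ideal.mem_map_of_mem _ hf
      exact h1 h
    · intro h
      have h1 : Ideal.map (C (σ := Fin (n+1))) J ≤
          Ideal.comap e.symm (Ideal.map (rename (R := k) (Sum.inr : Fin (m+1) → Fin (n+1) ⊕ Fin (m+1))) J) := by
        rw [Ideal.map_le_iff_le_comap]
        intro f hf
        rw [Ideal.mem_comap, Ideal.mem_comap, ← he, AlgEquiv.symm_apply_apply]
        exact Ideal.mem_map_of_mem _ hf
      have h2 := h1 h
      rwa [Ideal.mem_comap, AlgEquiv.symm_apply_apply] at h2
  intro g hg
  rw [key, mem_map_C_iff]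
  intro d
  rw [Submodule.mem_finsetInf] at hg ⊢
  intro i hi
  exact mem_map_C_iff.1 ((key _ _).1 (hg i hi)) d

lemma chainB (J : Ideal (MvPolynomial (Fin (m + 1)) k)) (b : Fin m → k) :
    ∃ f ∈ J, J ≤ Ideal.span {f} ⊔ (J ⊓ IB b) := by
  let ψ : MvPolynomial (Fin (m + 1)) k →ₐ[k] Polynomial k :=
    aeval (fun j => Polynomial.C ((Fin.cons 1 b : Fin (m+1) → k) j) * Polynomial.X)
  let s : Polynomial k →ₐ[k] MvPolynomial (Fin (m + 1)) k := Polynomial.aeval (X 0)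
  have hs : s.comp ψ = sub (Fin.cons 0 b) (fun _ => 0) (Finset.univ.image Fin.succ) := by
    apply MvPolynomial.algHom_ext
    intro i
    refine Fin.cases ?_ (fun i => ?_) i
    · rw [sub_X_not_mem _ _ _ (by simp [Fin.succ_ne_zero])]
      simp [ψ, s]
    · rw [sub_X_mem _ _ _ (by simp)]
      simp [ψ, s, algebraMap_eq]
  have hψ : Function.Surjective ψ := by
    have : ψ.comp s = AlgHom.id k _ := by
      apply Polynomial.algHom_ext
      simp [ψ, s]
    intro q
    exact ⟨s q, congrArg (fun φ => φ q) this⟩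
  obtain ⟨q, hq⟩ := IsPrincipalIdealRing.principal (Ideal.map ψ J)
  have hq' : q ∈ Ideal.map ψ J := by
    rw [hq]; exact Submodule.mem_span_singleton_self q
  obtain ⟨f, hf, hfq⟩ := (Ideal.mem_map_iff_of_surjective ψ hψ).1 hq'
  refine ⟨f, hf, fun g hg => ?_⟩
  have h1 : ψ g ∈ Ideal.map ψ J := Ideal.mem_map_of_mem _ hg
  rw [hq] at h1
  obtain ⟨h, hh⟩ := Submodule.mem_span_singleton.1 h1
  obtain ⟨h, rfl⟩ := hψ h
  refine Ideal.mem_span_singleton_sup.2 ⟨h, g - h * f, ⟨?_, ?_⟩, by ring⟩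
  · exact J.sub_mem hg (J.mul_mem_left _ hf)
  · rw [IB]
    refine (mem_linI _ _ _ (by simp [Fin.succ_ne_zero]) _).2 ?_
    rw [← hs]
    have : ψ (g - h * f) = 0 := by
      rw [map_sub, map_mul, ← hh]
      change _ - _ * ψ f = 0
      rw [show ψ f = q from hfq]
      simp
    simp [this]

lemma chainS {ι : Type} (s : Finset ι) (Q : ι → Fin m → k) (b : Fin m → k) :
    ∃ F ∈ s.inf (fun j => Ib n m (Q j)),
      s.inf (fun j => Ib n m (Q j)) ≤ Ideal.span {F} ⊔ (s.inf (fun j => Ib n m (Q j)) ⊓ Ib n m b) := by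
  obtain ⟨f, hf, h⟩ := chainB (s.inf (fun j => IB (Q j))) b
  have hle : Ideal.map (rename (R := k) (Sum.inr : Fin (m+1) → Fin (n+1) ⊕ Fin (m+1)))
      (s.inf (fun j => IB (Q j))) ≤ s.inf (fun j => Ib n m (Q j)) := by
    refine Finset.le_inf fun j hj => ?_
    rw [← map_IB]
    exact Ideal.map_mono (Finset.inf_le hj)
  refine ⟨rename Sum.inr f, hle (Ideal.mem_map_of_mem _ hf), ?_⟩
  have h1 := map_inf (n := n) s (fun j => IB (Q j))
  simp only [map_IB] at h1
  refine (h1.trans (Ideal.map_mono h)).trans ?_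
  rw [Ideal.map_sup, Ideal.map_span, Set.image_singleton]
  refine sup_le_sup_left (le_inf ?_ ?_) _
  · exact (Ideal.map_mono inf_le_left).trans hle
  · rw [← map_IB]
    exact Ideal.map_mono inf_le_right

lemma fiber {ι : Type} [DecidableEq ι] (a : Fin n → k) (Q : ι → Fin m → k) (hQ : Function.Injective Q)
    (s : Finset ι) :
    PdLT (Ia n m a ⊔ s.inf (fun j => Ib n m (Q j))) (n + m + 1) ∧
    (s.Nonempty → ¬ PdLT (Ia n m a ⊔ s.inf (fun j => Ib n m (Q j))) (n + m)) := by
  induction s using Finset.induction_on with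
  | empty => simpa using pd_top _
  | insert j s hj ih =>
    obtain ⟨F, hF, hle⟩ := chainS (n := n) s Q (Q j)
    have hCp := Iab_prime a (Q j)
    have hFC : F ∉ Ia n m a ⊔ Ib n m (Q j) := by
      intro hFC
      have : s.inf (fun j => Ib n m (Q j)) ≤ Ia n m a ⊔ Ib n m (Q j) := by
        refine hle.trans (sup_le ?_ (inf_le_right.trans le_sup_right))
        rwa [Ideal.span_singleton_le_iff_mem]
      obtain ⟨i, hi, h⟩ := hCp.inf_le'.1 this
      exact hj (hQ (Ib_le_Iab h) ▸ hi)
    have hins : (insert j s).inf (fun j => Ib n m (Q j)) =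
      s.inf (fun j => Ib n m (Q j)) ⊓ Ib n m (Q j) := by rw [Finset.inf_insert, inf_comm]
    have hC : ∀ g, g * F ∈ Ia n m a ⊔ (insert j s).inf (fun j => Ib n m (Q j)) ↔
        g ∈ Ia n m a ⊔ Ib n m (Q j) := by
      intro g
      rw [hins]
      constructor
      · intro h
        refine (hCp.mem_or_mem (?_ : g * F ∈ _)).resolve_right hFC
        have hle' : Ia n m a ⊔ (s.inf (fun j => Ib n m (Q j)) ⊓ Ib n m (Q j)) ≤
          Ia n m a ⊔ Ib n m (Q j) := sup_le_sup_left inf_le_right _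
        exact hle' h
      · intro h
        obtain ⟨p, hp, q, hq, rfl⟩ := Submodule.mem_sup.1 h
        rw [add_mul]
        refine Ideal.add_mem _ (Ideal.mem_sup_left (Ideal.mul_mem_right _ _ hp))
          (Ideal.mem_sup_right ⟨Ideal.mul_mem_left _ _ hF, Ideal.mul_mem_right _ _ hq⟩)
    have hQ' : Ia n m a ⊔ s.inf (fun j => Ib n m (Q j)) =
        (Ia n m a ⊔ (insert j s).inf (fun j => Ib n m (Q j))) ⊔ Ideal.span {F} := by
      rw [hins]
      apply le_antisymm
      · refine sup_le (le_sup_left.trans le_sup_left) (hle.trans (sup_le le_sup_right ?_))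
        exact le_sup_right.trans le_sup_left
      · refine sup_le (sup_le_sup_left inf_le_left _) ?_
        rw [Ideal.span_singleton_le_iff_mem]
        exact Ideal.mem_sup_right hF
    have hlin := linI_main (cc a (Q j)) (pp n m) (TA n m ∪ TB n m) _ hpAB subset_rfl
    have hnot := linI_not (cc a (Q j)) (pp n m) (TA n m ∪ TB n m) hpAB
    rw [card_AB, ← Iab_eq] at hlin hnot
    exact ⟨pd_mid _ _ _ F hC hQ' hlin.1 ih.1, fun _ h => hnot (pd_left _ _ _ F hC hQ' h ih.1)⟩

lemma xIdeal_eq (t : ℕ) : xIdeal k n m ^ t = degI k (Finset.univ.image Sum.inl) t := by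
  rw [degI_eq, xIdeal]
  congr 2
  ext g
  simp

lemma xIdeal_pd (t : ℕ) : PdLT (xIdeal k n m ^ t) (n + 2) := by
  rw [xIdeal_eq]
  have := degI_pd (k := k) (Finset.univ.image (Sum.inl : Fin (n+1) → Fin (n+1) ⊕ Fin (m+1))) t
  rwa [Finset.card_image_of_injective _ Sum.inl_injective, Finset.card_univ, Fintype.card_fin] at this

/-- projection to the fiber over `a` -/
abbrev sA (m : ℕ) (a : Fin n → k) : Cox k n m →ₐ[k] Cox k n m := sub (cc a 0) (pp n m) (TA n m)

lemma mem_Ia (a : Fin n → k) (g : Cox k n m) : g ∈ Ia n m a ↔ sA m a g = 0 := by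
  rw [Ia_eq a 0, mem_linI _ _ _ hpA]

lemma sub_sA_mem (a : Fin n → k) (g : Cox k n m) : g - sA m a g ∈ Ia n m a := by
  rw [Ia_eq a 0]; exact sub_sub_mem _ _ _ g

lemma sA_x0 (a : Fin n → k) : sA m a (X (Sum.inl 0)) = X (Sum.inl 0) :=
  sub_X_not_mem _ _ _ inl0_TA

lemma sA_xs (a : Fin n → k) (i : Fin n) :
    sA m a (X (Sum.inl i.succ)) = C (a i) * X (Sum.inl 0) := by
  rw [sA, sub_X_mem _ _ _ (by simp [TA])]
  simp [cc, pp]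

lemma sA_Ib (a : Fin n → k) (b : Fin m → k) {g : Cox k n m} (hg : g ∈ Ib n m b) :
    sA m a g ∈ Ib n m b := by
  have : Ib n m b ≤ Ideal.comap (sA m a) (Ib n m b) := by
    conv_lhs => rw [Ib]
    rw [Ideal.span_le]
    rintro _ ⟨j, rfl⟩
    simp only [SetLike.mem_coe, Ideal.mem_comap, map_sub, map_mul, sA, sub_C,
      sub_X_not_mem _ _ _ (inr_TA _)]
    exact Ideal.subset_span ⟨j, rfl⟩
  exact this hg

lemma mem_fiber {ι : Type} (a : Fin n → k) (Q : ι → Fin m → k) (s : Finset ι) (g : Cox k n m) :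
    g ∈ Ia n m a ⊔ s.inf (fun j => Ib n m (Q j)) ↔ ∀ j ∈ s, sA m a g ∈ Ib n m (Q j) := by
  constructor
  · intro h j hj
    obtain ⟨p, hp, q, hq, rfl⟩ := Submodule.mem_sup.1 h
    rw [map_add, (mem_Ia a p).1 hp, zero_add]
    exact sA_Ib a _ (Submodule.mem_finsetInf.1 hq j hj)
  · intro h
    rw [← sub_add_cancel g (sA m a g)]
    exact Ideal.add_mem _ (Ideal.mem_sup_left (sub_sA_mem a g))
      (Ideal.mem_sup_right (Submodule.mem_finsetInf.2 h))

lemma not_mem_Ib (b : Fin m → k) (u : k) (hu : u ≠ 0) (t : ℕ) :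
    (C u * X (Sum.inl 0) ^ t : Cox k n m) ∉ Ib n m b := by
  rw [Ib_eq 0 b, mem_linI _ _ _ hpB, map_mul, map_pow, sub_C, sub_X_not_mem _ _ _ (inl_TB _)]
  exact mul_ne_zero (by simpa using hu) (pow_ne_zero _ (X_ne_zero _))

lemma sA_pow (a : Fin n → k) (t : ℕ) {g : Cox k n m} (hg : g ∈ xIdeal k n m ^ t) :
    ∃ h, sA m a g = h * X (Sum.inl 0) ^ t := by
  have h1 : sA m a g ∈ Ideal.map (sA m a) (xIdeal k n m ^ t) := Ideal.mem_map_of_mem _ hg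
  rw [Ideal.map_pow] at h1
  have h2 : Ideal.map (sA m a) (xIdeal k n m) ≤ Ideal.span {X (Sum.inl 0)} := by
    rw [xIdeal, Ideal.map_span, Ideal.span_le]
    rintro _ ⟨_, ⟨i, rfl⟩, rfl⟩
    refine Fin.cases ?_ (fun i => ?_) i
    · simp only [sA_x0]; exact Ideal.subset_span rfl
    · simp only [sA_xs]; exact Ideal.mul_mem_left _ _ (Ideal.subset_span rfl)
  have h3 := Ideal.pow_right_mono h2 t h1
  rw [Ideal.span_singleton_pow, Ideal.mem_span_singleton'] at h3
  obtain ⟨h, hh⟩ := h3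
  exact ⟨h, hh.symm⟩

lemma x_mem (i) : (X (Sum.inl i) : Cox k n m) ∈ xIdeal k n m := Ideal.subset_span ⟨i, rfl⟩

lemma sep {ℓ : ℕ} (P : Fin ℓ → Fin n → k) (hP : Function.Injective P) (a : Fin ℓ)
    (s : Finset (Fin ℓ)) (has : a ∉ s) :
    ∃ f ∈ xIdeal k n m ^ s.card, (∀ j ∈ s, f ∈ Ia n m (P j)) ∧
      ∃ u : k, u ≠ 0 ∧ sA m (P a) f = C u * X (Sum.inl 0) ^ s.card := by
  induction s using Finset.induction_on with
  | empty => exact ⟨1, by simp, by simp, 1, one_ne_zero, by simp⟩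
  | insert j s hj ih =>
    obtain ⟨f, hf, hfs, u, hu, hfu⟩ := ih (fun h => has (Finset.mem_insert_of_mem h))
    have hne : P j ≠ P a := fun h => has (hP h ▸ Finset.mem_insert_self _ _)
    obtain ⟨i, hi⟩ := Function.ne_iff.1 hne
    have hl : (C (P j i) * X (Sum.inl 0) - X (Sum.inl i.succ) : Cox k n m) ∈ Ia n m (P j) :=
      Ideal.subset_span ⟨i, rfl⟩
    refine ⟨f * (C (P j i) * X (Sum.inl 0) - X (Sum.inl i.succ)), ?_, ?_, u * (P j i - P a i),
      mul_ne_zero hu (sub_ne_zero.2 hi), ?_⟩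
    · rw [Finset.card_insert_of_notMem hj, pow_succ]
      exact Ideal.mul_mem_mul hf (Ideal.sub_mem _ (Ideal.mul_mem_left _ _ (x_mem _)) (x_mem _))
    · intro i hi
      rcases Finset.mem_insert.1 hi with rfl | hi
      · exact Ideal.mul_mem_left _ _ hl
      · exact Ideal.mul_mem_right _ _ (hfs i hi)
    · rw [Finset.card_insert_of_notMem hj, map_mul, hfu, map_sub, map_mul, sA_x0, sA_xs, sA, sub_C,
        C_mul, C_sub]
      ring

lemma IXk_eq {ℓ : ℕ} (P : Fin ℓ → Fin n → k) (r : Fin ℓ → ℕ)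
    (Q : (a : Fin ℓ) → Fin (r a) → Fin m → k) (a : Fin ℓ) :
    IXk n m P r Q a = Ia n m (P a) ⊔ Finset.univ.inf (fun j => Ib n m (Q a j)) := by
  rw [IXk, Finset.inf_univ_eq_iInf]; rfl

lemma main_ind (hm : 1 ≤ m) {ℓ : ℕ} (P : Fin ℓ → Fin n → k) (hP : Function.Injective P)
    (r : Fin ℓ → ℕ) (hr : ∀ a, 1 ≤ r a)
    (Q : (a : Fin ℓ) → Fin (r a) → Fin m → k)
    (hQ : ∀ a, Function.Injective (Q a))
    (t : ℕ) (s : Finset (Fin ℓ)) (hs : s.card ≤ t + 1) :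
    PdLT (s.inf (fun a => IXk n m P r Q a) ⊓ xIdeal k n m ^ t) (n + m + 1) ∧
    (s.Nonempty → ¬ PdLT (s.inf (fun a => IXk n m P r Q a) ⊓ xIdeal k n m ^ t) (n + m)) := by
  induction s using Finset.induction_on with
  | empty => simpa using pd_mono (xIdeal_pd t) (by omega)
  | insert a s ha ih =>
    rw [Finset.card_insert_of_notMem ha] at hs
    obtain ⟨h3, -⟩ := ih (by omega)
    obtain ⟨f₀, hf₀, hfs₀, u, hu, hfu₀⟩ := sep (m := m) P hP a s ha
    obtain ⟨e, rfl⟩ : ∃ e, t = s.card + e := ⟨t - s.card, by omega⟩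
    set t := s.card + e
    obtain ⟨f, hf, hfs, hfu⟩ : ∃ f ∈ xIdeal k n m ^ t, (∀ j ∈ s, f ∈ Ia n m (P j)) ∧
        sA m (P a) f = C u * X (Sum.inl 0) ^ t := by
      refine ⟨f₀ * X (Sum.inl 0) ^ e, ?_, fun j hj => Ideal.mul_mem_right _ _ (hfs₀ j hj), ?_⟩
      · rw [pow_add]
        exact Ideal.mul_mem_mul hf₀ (Ideal.pow_mem_pow (x_mem _) _)
      · rw [map_mul, map_pow, hfu₀, sA_x0, pow_add, mul_assoc]
    have hIa : ∀ j, Ia n m (P j) ≤ IXk n m P r Q j := fun j => by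
      rw [IXk_eq]; exact le_sup_left
    have hfI : f ∈ s.inf (fun a => IXk n m P r Q a) :=
      Submodule.mem_finsetInf.2 fun j hj => hIa j (hfs j hj)
    have hC : ∀ g, g * f ∈ (insert a s).inf (fun a => IXk n m P r Q a) ⊓ xIdeal k n m ^ t ↔
        g ∈ IXk n m P r Q a := by
      intro g
      rw [Finset.inf_insert]
      constructor
      · rintro ⟨⟨h, -⟩, -⟩
        have h : g * f ∈ IXk n m P r Q a := h
        rw [IXk_eq, mem_fiber] at h ⊢
        intro j hj
        have := h j hj
        rw [map_mul, hfu] at this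
        exact ((Ib_prime _).mem_or_mem this).resolve_right (not_mem_Ib _ u hu t)
      · intro h
        exact ⟨⟨Ideal.mul_mem_right _ _ h, Ideal.mul_mem_left _ _ hfI⟩, Ideal.mul_mem_left _ _ hf⟩
    have hQ' : s.inf (fun a => IXk n m P r Q a) ⊓ xIdeal k n m ^ t =
        ((insert a s).inf (fun a => IXk n m P r Q a) ⊓ xIdeal k n m ^ t) ⊔ Ideal.span {f} := by
      rw [Finset.inf_insert]
      apply le_antisymm
      · rintro g ⟨hg1, hg2⟩
        obtain ⟨h, hh⟩ := sA_pow (P a) t hg2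
        have hh' : sA m (P a) g = sA m (P a) h * X (Sum.inl 0) ^ t := by
          have := (mem_Ia _ _).1 (sub_sA_mem (P a) g)
          rw [map_sub, sub_eq_zero] at this
          rw [this, hh, map_mul, map_pow, sA_x0]
        rw [sup_comm]
        have hg' : g - C u⁻¹ * h * f ∈ Ia n m (P a) := by
          rw [mem_Ia, map_sub, map_mul, map_mul, hfu, hh', sA, sub_C]
          have : (C u⁻¹ * C u : Cox k n m) = 1 := by rw [← C_mul, inv_mul_cancel₀ hu, C_1]
          linear_combination (-(sub (cc (P a) 0) (pp n m) (TA n m) h) * X (Sum.inl 0) ^ t) * this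
        refine Ideal.mem_span_singleton_sup.2 ⟨C u⁻¹ * h, g - C u⁻¹ * h * f, ⟨⟨hIa a hg', ?_⟩, ?_⟩, by ring⟩
        · exact Ideal.sub_mem _ hg1 (Ideal.mul_mem_left _ _ hfI)
        · exact Ideal.sub_mem _ hg2 (Ideal.mul_mem_left _ _ hf)
      · refine sup_le (inf_le_inf_right _ inf_le_right) ?_
        rw [Ideal.span_singleton_le_iff_mem]
        exact ⟨hfI, hf⟩
    have hfib := fiber (P a) (Q a) (hQ a) Finset.univ
    rw [← IXk_eq] at hfib
    have hne : (Finset.univ : Finset (Fin (r a))).Nonempty := ⟨⟨0, hr a⟩, Finset.mem_univ _⟩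
    exact ⟨pd_mid _ _ _ f hC hQ' hfib.1 h3, fun _ h => hfib.2 hne (pd_left _ _ _ f hC hQ' h h3)⟩

end final

/-- **Theorem 1.1** (length statement): for every `t ≥ ℓ - 1`, the `S`-module
`S/(I_X ∩ ⟨x⟩^t)` has projective dimension exactly `n + m`, i.e. its minimal free
resolution over `S` has length `n + m`.  Projective dimension is expressed via the
standard Ext-characterization: `Ext^{n+m+1}(M, -) ≡ 0` (so `pd ≤ n+m`), while
`Ext^{n+m}(M, N) ≠ 0` for some `N` (so `pd ≥ n+m`). -/
theorem stmt10 (k : Type) [Field k] [IsAlgClosed k] (n m : ℕ) (hn : 1 ≤ n) (hm : 1 ≤ m)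
    (ℓ : ℕ) (hℓ : 1 ≤ ℓ)
    (P : Fin ℓ → Fin n → k) (hP : Function.Injective P)
    (r : Fin ℓ → ℕ) (hr : ∀ a, 1 ≤ r a)
    (Q : (a : Fin ℓ) → Fin (r a) → Fin m → k)
    (hQ : ∀ a, Function.Injective (Q a))
    (t : ℕ) (ht : ℓ - 1 ≤ t) :
    ExtVanishes (Cox k n m)
        (ModuleCat.of (Cox k n m)
          (Cox k n m ⧸ ((⨅ a : Fin ℓ, IXk n m P r Q a) ⊓ xIdeal k n m ^ t)))
        (n + m + 1) ∧
      ¬ ExtVanishes (Cox k n m)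
        (ModuleCat.of (Cox k n m)
          (Cox k n m ⧸ ((⨅ a : Fin ℓ, IXk n m P r Q a) ⊓ xIdeal k n m ^ t)))
        (n + m) := by
  have h := main_ind hm P hP r hr Q hQ t Finset.univ (by simp; omega)
  rw [Finset.inf_univ_eq_iInf] at h
  obtain ⟨e, rfl⟩ : ∃ e, m = e + 1 := ⟨m - 1, by omega⟩
  exact ⟨(extV_iff _ _ _).2 h.1,
    fun h' => h.2 ⟨⟨0, hℓ⟩, Finset.mem_univ _⟩ ((extV_iff _ _ (n + e)).1 h')⟩
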